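/- arXiv:2007.11138 — 3 statements merged into one kernel-verified Lean document; each statement's English description precedes it below -/
import Mathlib

section
/- Consider the Gaussian additive model. For every N and every λ > 0, the function β ↦ (1/λ)·D(Q_{βλ,N} ‖ Q_{0,N}) on [0, ∞) is nonnegative, nondecreasing, and (1/2)-Lipschitz. -/
open MeasureTheory ProbabilityTheory Filter Real
open scoped ENNReal NNReal

noncomputable section

/-- Vectors in `ℝ^N`. -/
abbrev V (N : ℕ) : Type := Fin N → ℝ

/-- Euclidean inner product on `ℝ^N`. -/
def inp {N : ℕ} (x y : V N) : ℝ := ∑ i, x i * y i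

/-- `S` is a subset of the unit sphere of `ℝ^N`. -/
def onSphere {N : ℕ} (S : Finset (V N)) : Prop := ∀ x ∈ S, ∑ i, (x i) ^ 2 = 1

/-- The standard Gaussian measure on `ℝ^N`. -/
def stdGaussian (N : ℕ) : Measure (V N) :=
  Measure.pi fun _ : Fin N => gaussianReal 0 1

/-- The uniform probability measure on a finite set of vectors. -/
def unifOn {N : ℕ} (S : Finset (V N)) : Measure (V N) :=
  (S.card : ℝ≥0∞)⁻¹ • ∑ x ∈ S, Measure.dirac x

/-- The joint law of `(X, Y)` where `X` is uniform on `S`, `Z` is an independent standard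
Gaussian vector, and `Y = √λ • X + Z`. -/
def jointLaw (N : ℕ) (S : Finset (V N)) (lam : ℝ) : Measure (V N × V N) :=
  ((unifOn S).prod (stdGaussian N)).map
    (fun q => (q.1, fun i => Real.sqrt lam * q.1 i + q.2 i))

/-- `Q N S lam` : the law of the observation `Y = √λ • X + Z`. -/
def Q (N : ℕ) (S : Finset (V N)) (lam : ℝ) : Measure (V N) :=
  (jointLaw N S lam).map Prod.snd

/-- Kullback–Leibler divergence `D(μ ‖ ν) = ∫ log (dμ/dν) dμ` (real-valued). -/
def klReal {α : Type*} [MeasurableSpace α] (μ ν : Measure α) : ℝ :=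
  ∫ x, Real.log (μ.rnDeriv ν x).toReal ∂μ

/-- The σ-algebra generated by the observation `Y` (the second coordinate). -/
def sigmaY (N : ℕ) : MeasurableSpace (V N × V N) :=
  MeasurableSpace.comap Prod.snd inferInstance

/-- The minimum mean squared error `E‖X - E[X | Y]‖²` at SNR `lam`. -/
def mmse (N : ℕ) (S : Finset (V N)) (lam : ℝ) : ℝ :=
  ∑ i : Fin N,
    ∫ ω, (ω.1 i - ((jointLaw N S lam)[fun ω' => ω'.1 i | sigmaY N]) ω) ^ 2
      ∂(jointLaw N S lam)

/-- The all-or-nothing phenomenon with critical SNR sequence `lam`. -/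
def allOrNothing (S : ∀ N : ℕ, Finset (V N)) (lam : ℕ → ℝ) : Prop :=
  (∀ β : ℝ, 0 ≤ β → β < 1 →
    Tendsto (fun N => mmse N (S N) (β * lam N)) atTop (nhds 1)) ∧
  (∀ β : ℝ, 1 < β →
    Tendsto (fun N => mmse N (S N) (β * lam N)) atTop (nhds 0))

/-- `limsup_N (1 / log M_N) · log P_N^{⊗2}[⟨X, X'⟩ ≥ t] ≤ c`, where `X, X'` are i.i.d.
draws from the uniform distribution on `S N`: for every `ε > 0`, eventually the probability
that the overlap is at least `t` is at most `M_N ^ (c + ε)`. -/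
def overlapRateLe (S : ∀ N : ℕ, Finset (V N)) (t c : ℝ) : Prop :=
  ∀ ε : ℝ, 0 < ε → ∀ᶠ N in atTop,
    ((unifOn (S N)).prod (unifOn (S N))) {q | t ≤ inp q.1 q.2}
      ≤ ((S N).card : ℝ≥0∞) ^ (c + ε)

/-- The spread assumption: `lim_{t→1⁻} limsup_N (1/log M_N) log P_N^{⊗2}[⟨X,X'⟩ ≥ t] ≤ -1`. -/
def spread (S : ∀ N : ℕ, Finset (V N)) : Prop :=
  ∀ ε : ℝ, 0 < ε → ∃ t₀ : ℝ, t₀ < 1 ∧ ∀ t : ℝ, t₀ < t → t < 1 →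
    overlapRateLe S t (-1 + ε)


open InformationTheory

instance instProbStd (N : ℕ) : IsProbabilityMeasure (stdGaussian N) := by
  unfold _root_.stdGaussian; infer_instance

lemma unifOn_prob {N : ℕ} {S : Finset (V N)} (hne : S.Nonempty) :
    IsProbabilityMeasure (unifOn S) := by
  constructor
  have h0 : (S.card : ℝ≥0∞) ≠ 0 := by simpa using hne.ne_empty
  simp [unifOn, ENNReal.inv_mul_cancel h0]

lemma gauss1_rot (c d : ℝ) (h : c ^ 2 + d ^ 2 = 1) :
    ((gaussianReal 0 1).prod (gaussianReal 0 1)).map (fun p : ℝ × ℝ => c * p.1 + d * p.2)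
      = gaussianReal 0 1 := by
  have h1 : (fun p : ℝ × ℝ => c * p.1 + d * p.2)
      = (fun p : ℝ × ℝ => p.1 + p.2) ∘ (Prod.map (fun x => c * x) (fun x => d * x)) := by
    ext p; simp
  rw [h1, ← Measure.map_map (by fun_prop) (by fun_prop),
    ← Measure.map_prod_map _ _ (by fun_prop) (by fun_prop),
    gaussianReal_map_const_mul, gaussianReal_map_const_mul]
  have := gaussianReal_conv_gaussianReal (m₁ := c * 0) (m₂ := d * 0)
    (v₁ := NNReal.mk (c ^ 2) (sq_nonneg _) * 1) (v₂ := NNReal.mk (d ^ 2) (sq_nonneg _) * 1)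
  rw [Measure.conv] at this
  rw [this]
  congr 1
  · simp
  · ext; simpa using h

lemma gauss_rot (N : ℕ) (c d : ℝ) (h : c ^ 2 + d ^ 2 = 1) :
    ((stdGaussian N).prod (stdGaussian N)).map
      (fun p : V N × V N => fun i => c * p.1 i + d * p.2 i) = stdGaussian N := by
  unfold _root_.stdGaussian
  rw [← (measurePreserving_arrowProdEquivProdArrow ℝ ℝ (Fin N) (fun _ => gaussianReal 0 1)
    (fun _ => gaussianReal 0 1)).map_eq, Measure.map_map (by fun_prop) (by fun_prop)]
  have : (fun p : V N × V N => fun i => c * p.1 i + d * p.2 i) ∘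
      (MeasurableEquiv.arrowProdEquivProdArrow ℝ ℝ (Fin N))
      = fun (q : Fin N → ℝ × ℝ) i => (fun p : ℝ × ℝ => c * p.1 + d * p.2) (q i) := by
    ext q i; rfl
  rw [this]
  have hp : ∀ i : Fin N, IsProbabilityMeasure (((gaussianReal 0 1).prod (gaussianReal 0 1)).map (fun p : ℝ × ℝ => c * p.1 + d * p.2)) := by
    intro i; rw [gauss1_rot c d h]; infer_instance
  rw [Measure.pi_map_pi (f := fun (_ : Fin N) (p : ℝ × ℝ) => c * p.1 + d * p.2)
    (fun i => by fun_prop)]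
  simp_rw [gauss1_rot c d h]

lemma gauss1_shift (a : ℝ) :
    (gaussianReal 0 1).map (fun x => a + x)
      = (gaussianReal 0 1).withDensity (fun y => ENNReal.ofReal (rexp (a * y - a ^ 2 / 2))) := by
  rw [gaussianReal_map_const_add, gaussianReal_of_var_ne_zero _ (by simp),
    gaussianReal_of_var_ne_zero _ (by simp), ← withDensity_mul _ (by fun_prop) (by fun_prop)]
  congr 1
  ext y
  simp only [gaussianPDF, Pi.mul_apply]
  rw [← ENNReal.ofReal_mul (gaussianPDFReal_nonneg _ _ _)]
  congr 1
  simp only [gaussianPDFReal]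
  rw [mul_assoc _ (rexp _) (rexp _), ← Real.exp_add]
  congr 2
  simp; ring

lemma pi_withDensity_aux {N : ℕ} (m : Measure ℝ) [IsProbabilityMeasure m]
    (g : Fin N → ℝ → ℝ≥0∞) (hg : ∀ i, Measurable (g i))
    [∀ i, SigmaFinite (m.withDensity (g i))] :
    Measure.pi (fun i => m.withDensity (g i))
      = (Measure.pi (fun _ : Fin N => m)).withDensity (fun y => ∏ i, g i (y i)) := by
  refine Measure.pi_eq (fun s hs => ?_)
  rw [withDensity_apply _ (MeasurableSet.univ_pi hs), ← lintegral_indicator (MeasurableSet.univ_pi hs)]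
  have h1 : (fun y : Fin N → ℝ => (Set.univ.pi s).indicator (fun y => ∏ i, g i (y i)) y)
      = fun y => ∏ i, (s i).indicator (g i) (y i) := by
    ext y
    by_cases hy : y ∈ Set.univ.pi s
    · rw [Set.indicator_of_mem hy]
      exact Finset.prod_congr rfl fun i _ => (Set.indicator_of_mem (hy i trivial) _).symm
    · rw [Set.indicator_of_notMem hy]
      simp only [Set.mem_pi, not_forall] at hy
      obtain ⟨i, _, hi⟩ := hy
      exact (Finset.prod_eq_zero (Finset.mem_univ i) (Set.indicator_of_notMem hi _)).symm
  rw [h1]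
  have hm : ∀ i, Measurable ((s i).indicator (g i)) := fun i => (hg i).indicator (hs i)
  rw [lintegral_prod_eq_prod_lintegral_of_indepFun Finset.univ
    (fun i (y : Fin N → ℝ) => (s i).indicator (g i) (y i))
    (iIndepFun_pi (fun i => (hm i).aemeasurable)) (fun i => (hm i).comp (measurable_pi_apply i))]
  refine Finset.prod_congr rfl fun i _ => ?_
  rw [withDensity_apply _ (hs i), ← lintegral_indicator (hs i)]
  exact ((measurePreserving_eval (fun _ : Fin N => m) i).lintegral_comp (hm i))

lemma gauss_shift (N : ℕ) (a : V N) :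
    (stdGaussian N).map (fun z => fun i => a i + z i)
      = (stdGaussian N).withDensity
          (fun y => ENNReal.ofReal (rexp (∑ i, (a i * y i - a i ^ 2 / 2)))) := by
  unfold _root_.stdGaussian
  have hp : ∀ i, SigmaFinite ((gaussianReal 0 1).map (fun x => a i + x)) := by
    intro i; rw [gaussianReal_map_const_add]; infer_instance
  have hp' : ∀ i, SigmaFinite ((gaussianReal 0 1).withDensity
      (fun y => ENNReal.ofReal (rexp (a i * y - a i ^ 2 / 2)))) := by
    intro i; rw [← gauss1_shift]; exact hp i
  rw [Measure.pi_map_pi (f := fun i x => a i + x) (fun i => by fun_prop)]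
  simp_rw [gauss1_shift]
  rw [pi_withDensity_aux (gaussianReal 0 1)
    (fun i y => ENNReal.ofReal (rexp (a i * y - a i ^ 2 / 2))) (fun i => by fun_prop)]
  congr 1
  ext y
  rw [Real.exp_sum, ENNReal.ofReal_prod_of_nonneg (fun i _ => (Real.exp_pos _).le)]

/-- The joint law of `(Y, X)`. -/
def JJ (N : ℕ) (S : Finset (V N)) (r : ℝ) : Measure (V N × V N) :=
  ((unifOn S).prod (_root_.stdGaussian N)).map (fun q => (fun i => r * q.1 i + q.2 i, q.1))

lemma Q_eq_fst (N : ℕ) (S : Finset (V N)) (t : ℝ) : Q N S t = (JJ N S (√t)).fst := by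
  unfold Q jointLaw JJ Measure.fst
  rw [Measure.map_map (by fun_prop) (by fun_prop), Measure.map_map (by fun_prop) (by fun_prop)]
  rfl

lemma JJ_prob {N : ℕ} {S : Finset (V N)} (hne : S.Nonempty) (r : ℝ) :
    IsProbabilityMeasure (JJ N S r) := by
  have := unifOn_prob hne
  exact Measure.isProbabilityMeasure_map (by fun_prop)

lemma JJ_snd {N : ℕ} {S : Finset (V N)} (r : ℝ) : (JJ N S r).snd = unifOn S := by
  unfold JJ Measure.snd
  rw [Measure.map_map (by fun_prop) (by fun_prop)]
  have : (Prod.snd ∘ fun q : V N × V N => ((fun i => r * q.1 i + q.2 i : V N), q.1)) = Prod.fst := rfl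
  rw [this]
  simp

lemma Q_zero {N : ℕ} {S : Finset (V N)} (hne : S.Nonempty) : Q N S 0 = _root_.stdGaussian N := by
  have := unifOn_prob hne
  rw [Q_eq_fst]
  unfold JJ Measure.fst
  rw [Measure.map_map (by fun_prop) (by fun_prop)]
  have : (Prod.fst ∘ fun q : V N × V N => ((fun i => √0 * q.1 i + q.2 i : V N), q.1)) = Prod.snd := by
    ext q i; simp
  rw [this]
  simp

lemma JJ_density {N : ℕ} {S : Finset (V N)} (hne : S.Nonempty) (r : ℝ) :
    JJ N S r = ((_root_.stdGaussian N).prod (unifOn S)).withDensity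
      (fun p => ENNReal.ofReal (rexp (∑ i, (r * p.2 i * p.1 i - (r * p.2 i) ^ 2 / 2)))) := by
  have := unifOn_prob hne
  refine Measure.ext_of_lintegral _ (fun f hf => ?_)
  unfold JJ
  rw [lintegral_map hf (by fun_prop), lintegral_prod _ (by fun_prop),
    lintegral_withDensity_eq_lintegral_mul _ (by fun_prop) hf,
    lintegral_prod_symm _ (by fun_prop)]
  refine lintegral_congr (fun x => ?_)
  have h := gauss_shift N (fun i => r * x i)
  have h2 := lintegral_map (μ := _root_.stdGaussian N) (f := fun y => f (y, x))
    (g := fun z : V N => fun i => r * x i + z i) (by fun_prop) (by fun_prop)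
  rw [← h2, h, lintegral_withDensity_eq_lintegral_mul _ (by fun_prop) (by fun_prop)]
  rfl

lemma JJ_ac {N : ℕ} {S : Finset (V N)} (hne : S.Nonempty) (r : ℝ) :
    JJ N S r ≪ (_root_.stdGaussian N).prod (unifOn S) := by
  rw [JJ_density hne]; exact withDensity_absolutelyContinuous _ _

lemma JJ_llr {N : ℕ} {S : Finset (V N)} (hne : S.Nonempty) (r : ℝ) :
    llr (JJ N S r) ((_root_.stdGaussian N).prod (unifOn S)) =ᵐ[JJ N S r]
      fun p => ∑ i, (r * p.2 i * p.1 i - (r * p.2 i) ^ 2 / 2) := by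
  have := unifOn_prob hne
  have h := Measure.rnDeriv_withDensity ((_root_.stdGaussian N).prod (unifOn S))
    (f := fun p => ENNReal.ofReal (rexp (∑ i, (r * p.2 i * p.1 i - (r * p.2 i) ^ 2 / 2))))
    (by fun_prop)
  rw [← JJ_density hne] at h
  filter_upwards [(JJ_ac hne r).ae_le h] with p hp
  rw [llr, hp, ENNReal.toReal_ofReal (Real.exp_pos _).le, Real.log_exp]

lemma integrable_unifOn {N : ℕ} {S : Finset (V N)} (hne : S.Nonempty) (f : V N → ℝ)
    : Integrable f (unifOn S) := by
  have h0 : (S.card : ℝ≥0∞) ≠ 0 := by simpa using hne.ne_empty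
  unfold unifOn
  refine Integrable.smul_measure ?_ (by simpa using hne.ne_empty)
  rw [integrable_finsetSum_measure]
  intro x _
  exact integrable_dirac (by simp)

lemma integrable_coord (N : ℕ) (i : Fin N) :
    Integrable (fun z : V N => z i) (_root_.stdGaussian N) := by
  have h : Integrable (fun x : ℝ => x) (gaussianReal 0 1) := by
    exact (memLp_id_gaussianReal (μ := 0) (v := 1) 1).integrable (by simp)
  exact (measurePreserving_eval (fun _ : Fin N => gaussianReal 0 1) i).integrable_comp_of_integrable h

lemma integral_coord (N : ℕ) (i : Fin N) :
    ∫ z, z i ∂(_root_.stdGaussian N) = 0 := by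
  have h := integral_map (μ := _root_.stdGaussian N) (φ := fun z => z i)
    (measurable_pi_apply i).aemeasurable (f := fun x : ℝ => x) (by fun_prop)
  rw [← h]
  have h2 := (measurePreserving_eval (fun _ : Fin N => gaussianReal 0 1) i).map_eq
  have h3 : (_root_.stdGaussian N).map (fun z => z i) = gaussianReal 0 1 := h2
  rw [h3, integral_id_gaussianReal]

lemma kl_JJ {N : ℕ} {S : Finset (V N)} (hne : S.Nonempty) (hs : onSphere S) (r : ℝ) :
    klDiv (JJ N S r) ((_root_.stdGaussian N).prod (unifOn S)) = ENNReal.ofReal (r ^ 2 / 2) := by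
  have := unifOn_prob hne
  have := JJ_prob hne r
  have hm : AEStronglyMeasurable
      (fun p : V N × V N => ∑ i, (r * p.2 i * p.1 i - (r * p.2 i) ^ 2 / 2)) (JJ N S r) := by
    fun_prop
  have hi : ∀ i, Integrable (fun q : V N × V N => r * (q.1 i * q.2 i))
      ((unifOn S).prod (_root_.stdGaussian N)) := fun i =>
    ((integrable_unifOn hne (fun x => x i)).mul_prod (integrable_coord N i)).const_mul r
  have hi2 : Integrable (fun q : V N × V N => r ^ 2 / 2 * ∑ i, q.1 i ^ 2)
      ((unifOn S).prod (_root_.stdGaussian N)) :=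
    (integrable_unifOn hne (fun x => r ^ 2 / 2 * ∑ i, x i ^ 2)).comp_fst _
  have heq : ((fun p : V N × V N => ∑ i, (r * p.2 i * p.1 i - (r * p.2 i) ^ 2 / 2)) ∘
      fun q : V N × V N => ((fun i => r * q.1 i + q.2 i : V N), q.1))
      = fun q => (∑ i, r * (q.1 i * q.2 i)) + r ^ 2 / 2 * ∑ i, q.1 i ^ 2 := by
    ext q
    simp only [Function.comp]
    rw [Finset.mul_sum, ← Finset.sum_add_distrib]
    refine Finset.sum_congr rfl fun i _ => ?_
    ring
  have hint : Integrable (fun p : V N × V N => ∑ i, (r * p.2 i * p.1 i - (r * p.2 i) ^ 2 / 2))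
      (JJ N S r) := by
    unfold JJ
    rw [integrable_map_measure hm (by fun_prop), heq]
    exact (integrable_finsetSum _ fun i _ => hi i).add hi2
  have hll := (integrable_congr (JJ_llr hne r)).mpr hint
  have hval : ∫ p, llr (JJ N S r) ((_root_.stdGaussian N).prod (unifOn S)) p ∂(JJ N S r)
      = r ^ 2 / 2 := by
    rw [integral_congr_ae (JJ_llr hne r)]
    have h1 := integral_map (μ := (unifOn S).prod (_root_.stdGaussian N))
      (φ := fun q : V N × V N => ((fun i => r * q.1 i + q.2 i : V N), q.1)) (by fun_prop) hm
    refine h1.trans ?_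
    have h2 := congrArg (fun F => ∫ q, F q ∂((unifOn S).prod (_root_.stdGaussian N))) heq
    refine h2.trans ?_
    simp only
    rw [integral_add (integrable_finsetSum _ fun i _ => hi i) hi2,
      integral_finsetSum _ fun i _ => hi i]
    have h3 : ∀ i, ∫ q : V N × V N, r * (q.1 i * q.2 i)
        ∂((unifOn S).prod (_root_.stdGaussian N)) = 0 := by
      intro i
      rw [integral_const_mul, integral_prod_mul (fun x : V N => x i) (fun z : V N => z i),
        integral_coord]
      simp
    have h4 : (fun q : V N × V N => r ^ 2 / 2 * ∑ i, q.1 i ^ 2)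
        =ᵐ[(unifOn S).prod (_root_.stdGaussian N)] fun _ => r ^ 2 / 2 := by
      have h5 : ∀ᵐ x ∂(unifOn S), ∑ i, x i ^ 2 = 1 := by
        unfold unifOn
        refine Measure.ae_smul_measure ?_ _
        rw [ae_iff]
        have hms : MeasurableSet {x : V N | ¬ ∑ i, x i ^ 2 = 1} := by
          refine (measurableSet_eq_fun ?_ ?_).compl <;> fun_prop
        rw [Measure.finsetSum_apply]
        refine Finset.sum_eq_zero fun x hx => ?_
        rw [Measure.dirac_apply' _ hms]
        simp [hs x hx]
      have h6 := Measure.quasiMeasurePreserving_fst (μ := unifOn S) (ν := _root_.stdGaussian N)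
      filter_upwards [h6.ae h5] with q hq
      rw [hq, mul_one]
    rw [integral_congr_ae h4]
    simp [h3]
  rw [klDiv_of_ac_of_integrable (JJ_ac hne r) hll, hval]
  simp

lemma Q_ac {N : ℕ} {S : Finset (V N)} (hne : S.Nonempty) (r : ℝ) :
    (JJ N S r).fst ≪ _root_.stdGaussian N := by
  have := unifOn_prob hne
  have h := (JJ_ac hne r).map measurable_fst
  have h2 : ((_root_.stdGaussian N).prod (unifOn S)).map Prod.fst = _root_.stdGaussian N := by simp
  rw [h2] at h
  exact h

lemma chain {N : ℕ} {S : Finset (V N)} (hne : S.Nonempty) (hs : onSphere S) (r : ℝ) :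
    klDiv (JJ N S r).fst (_root_.stdGaussian N)
      + klDiv (JJ N S r) ((JJ N S r).fst.prod (unifOn S)) = ENNReal.ofReal (r ^ 2 / 2) := by
  have := unifOn_prob hne
  have := JJ_prob hne r
  have : Nonempty (V N) := ⟨0⟩
  rw [← kl_JJ hne hs r]
  have h := klDiv_compProd_eq_add (JJ N S r).fst (_root_.stdGaussian N) (JJ N S r).condKernel
    (Kernel.const (V N) (unifOn S))
  rw [(JJ N S r).disintegrate (JJ N S r).condKernel, Measure.compProd_const,
    Measure.compProd_const] at h
  exact h.symm

lemma klDiv_prod_right' {α β : Type*} [MeasurableSpace α] [MeasurableSpace β] (μ ν : Measure α)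
    [IsFiniteMeasure μ] [IsFiniteMeasure ν] (ρ : Measure β) [IsProbabilityMeasure ρ] :
    klDiv (μ.prod ρ) (ν.prod ρ) = klDiv μ ν := by
  rw [← Measure.compProd_const, ← Measure.compProd_const, klDiv_compProd_left]

lemma JJ_degrade {N : ℕ} {S : Finset (V N)} (hne : S.Nonempty) (r c d : ℝ)
    (h : c ^ 2 + d ^ 2 = 1) :
    ((JJ N S r).prod (_root_.stdGaussian N)).map
      (fun q : (V N × V N) × V N => ((fun i => c * q.1.1 i + d * q.2 i : V N), q.1.2))
      = JJ N S (c * r) := by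
  have := unifOn_prob hne
  have := JJ_prob hne r
  have e1 : (JJ N S r).prod (_root_.stdGaussian N) =
      (((unifOn S).prod (_root_.stdGaussian N)).prod (_root_.stdGaussian N)).map
        (Prod.map (fun q : V N × V N => ((fun i => r * q.1 i + q.2 i : V N), q.1)) id) := by
    rw [← Measure.map_prod_map _ _ (by fun_prop) (by fun_prop), Measure.map_id]
    rfl
  rw [e1, Measure.map_map (by fun_prop) (by fun_prop)]
  unfold JJ
  conv_rhs => rw [← gauss_rot N c d h]
  have e2 : (unifOn S).prod (((_root_.stdGaussian N).prod (_root_.stdGaussian N)).map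
      (fun p : V N × V N => fun i => c * p.1 i + d * p.2 i)) =
      ((unifOn S).prod ((_root_.stdGaussian N).prod (_root_.stdGaussian N))).map
        (Prod.map id (fun p : V N × V N => (fun i => c * p.1 i + d * p.2 i : V N))) := by
    rw [← Measure.map_prod_map _ _ (by fun_prop) (by fun_prop), Measure.map_id]
  rw [e2, Measure.map_map (by fun_prop) (by fun_prop), ← Measure.prodAssoc_prod,
    Measure.map_map (by fun_prop) (by fun_prop)]
  congr 1
  ext q i
  · simp [MeasurableEquiv.prodAssoc]; ring
  · rfl

lemma Q_degrade {N : ℕ} {S : Finset (V N)} (hne : S.Nonempty) (r c d : ℝ)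
    (h : c ^ 2 + d ^ 2 = 1) :
    ((JJ N S r).fst.prod (_root_.stdGaussian N)).map
      (fun q : V N × V N => (fun i => c * q.1 i + d * q.2 i : V N)) = (JJ N S (c * r)).fst := by
  have := unifOn_prob hne
  have := JJ_prob hne r
  rw [← JJ_degrade hne r c d h]
  have e1 : (JJ N S r).fst.prod (_root_.stdGaussian N)
      = ((JJ N S r).prod (_root_.stdGaussian N)).map (Prod.map Prod.fst id) := by
    rw [← Measure.map_prod_map _ _ (by fun_prop) (by fun_prop), Measure.map_id]
    rfl
  rw [e1, Measure.map_map (by fun_prop) (by fun_prop)]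
  unfold Measure.fst
  rw [Measure.map_map (by fun_prop) (by fun_prop)]
  rfl

lemma prod_degrade {N : ℕ} {S : Finset (V N)} (hne : S.Nonempty) (r c d : ℝ)
    (h : c ^ 2 + d ^ 2 = 1) :
    (((JJ N S r).fst.prod (unifOn S)).prod (_root_.stdGaussian N)).map
      (fun q : (V N × V N) × V N => ((fun i => c * q.1.1 i + d * q.2 i : V N), q.1.2))
      = (JJ N S (c * r)).fst.prod (unifOn S) := by
  have := unifOn_prob hne
  have := JJ_prob hne r
  rw [← Q_degrade hne r c d h]
  have e1 : (((JJ N S r).fst.prod (_root_.stdGaussian N)).map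
      (fun q : V N × V N => (fun i => c * q.1 i + d * q.2 i : V N))).prod (unifOn S)
      = (((JJ N S r).fst.prod (_root_.stdGaussian N)).prod (unifOn S)).map
        (Prod.map (fun q : V N × V N => (fun i => c * q.1 i + d * q.2 i : V N)) id) := by
    rw [← Measure.map_prod_map _ _ (by fun_prop) (by fun_prop), Measure.map_id]
  refine Measure.ext_of_lintegral _ (fun f hf => ?_)
  rw [e1, lintegral_map hf (by fun_prop), lintegral_map hf (by fun_prop),
    lintegral_prod _ (by fun_prop), lintegral_prod _ (by fun_prop), lintegral_prod _ (by fun_prop),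
    lintegral_prod _ (by fun_prop)]
  refine lintegral_congr fun y => ?_
  rw [lintegral_lintegral_swap (by fun_prop)]
  rfl

lemma kl_mono {N : ℕ} {S : Finset (V N)} (hne : S.Nonempty) (r c d : ℝ)
    (h : c ^ 2 + d ^ 2 = 1) :
    klDiv (JJ N S (c * r)).fst (_root_.stdGaussian N)
      ≤ klDiv (JJ N S r).fst (_root_.stdGaussian N) := by
  have := unifOn_prob hne
  have := JJ_prob hne r
  rw [← klDiv_prod_right' (JJ N S r).fst (_root_.stdGaussian N) (_root_.stdGaussian N),
    ← Q_degrade hne r c d h]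
  have hk := klDiv_map_le ((JJ N S r).fst.prod (_root_.stdGaussian N))
    ((_root_.stdGaussian N).prod (_root_.stdGaussian N))
    (g := fun q : V N × V N => (fun i => c * q.1 i + d * q.2 i : V N)) (by fun_prop)
  rw [gauss_rot N c d h] at hk
  exact hk

lemma mi_mono {N : ℕ} {S : Finset (V N)} (hne : S.Nonempty) (r c d : ℝ)
    (h : c ^ 2 + d ^ 2 = 1) :
    klDiv (JJ N S (c * r)) ((JJ N S (c * r)).fst.prod (unifOn S))
      ≤ klDiv (JJ N S r) ((JJ N S r).fst.prod (unifOn S)) := by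
  have := unifOn_prob hne
  have := JJ_prob hne r
  rw [← klDiv_prod_right' (JJ N S r) ((JJ N S r).fst.prod (unifOn S)) (_root_.stdGaussian N),
    ← prod_degrade hne r c d h, ← JJ_degrade hne r c d h]
  exact klDiv_map_le _ _ (by fun_prop)

lemma klReal_eq {N : ℕ} {S : Finset (V N)} (hne : S.Nonempty) (t : ℝ) :
    klReal (Q N S t) (Q N S 0) = (klDiv (JJ N S (√t)).fst (_root_.stdGaussian N)).toReal := by
  have := JJ_prob hne (√t)
  rw [Q_zero hne, Q_eq_fst, toReal_klDiv_of_measure_eq (Q_ac hne _) (by simp)]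
  rfl

lemma klReal_main {N : ℕ} {S : Finset (V N)} (hne : S.Nonempty) (hs : onSphere S) (s t : ℝ)
    (h0 : 0 ≤ s) (hst : s ≤ t) :
    klReal (Q N S s) (Q N S 0) ≤ klReal (Q N S t) (Q N S 0) ∧
    klReal (Q N S t) (Q N S 0) - klReal (Q N S s) (Q N S 0) ≤ (t - s) / 2 := by
  rcases hst.eq_or_lt with rfl | hlt
  · simp
  have ht : 0 < t := h0.trans_lt hlt
  have hc : √(s / t) ^ 2 + √(1 - s / t) ^ 2 = 1 := by
    rw [Real.sq_sqrt (by positivity), Real.sq_sqrt (by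
      rw [sub_nonneg]; exact (div_le_one ht).mpr hst)]
    ring
  have hcr : √(s / t) * √t = √s := by
    rw [← Real.sqrt_mul (by positivity), div_mul_cancel₀ _ ht.ne']
  have h1 := kl_mono hne (√t) _ _ hc
  have h2 := mi_mono hne (√t) _ _ hc
  rw [hcr] at h1 h2
  have c1 := chain hne hs (√s)
  have c2 := chain hne hs (√t)
  rw [Real.sq_sqrt h0] at c1
  rw [Real.sq_sqrt ht.le] at c2
  have f1 := ENNReal.add_ne_top.mp (c1 ▸ ENNReal.ofReal_ne_top)
  have f2 := ENNReal.add_ne_top.mp (c2 ▸ ENNReal.ofReal_ne_top)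
  have d1 := congrArg ENNReal.toReal c1
  have d2 := congrArg ENNReal.toReal c2
  rw [ENNReal.toReal_add f1.1 f1.2, ENNReal.toReal_ofReal (by linarith)] at d1
  rw [ENNReal.toReal_add f2.1 f2.2, ENNReal.toReal_ofReal (by linarith)] at d2
  have e1 := ENNReal.toReal_mono f2.1 h1
  have e2 := ENNReal.toReal_mono f2.2 h2
  rw [klReal_eq hne, klReal_eq hne]
  constructor <;> linarith

/-- Lemma 2 of the paper. For every `N` and `λ > 0`, the function
`β ↦ (1/λ) D(Q_{βλ,N} ‖ Q_{0,N})` on `[0,∞)` is nonnegative, nondecreasing, and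
`(1/2)`-Lipschitz. -/
theorem statement12 (N : ℕ) (S : Finset (V N)) (hne : S.Nonempty) (hsphere : onSphere S)
    (lam : ℝ) (hlam : 0 < lam) :
    (∀ β : ℝ, 0 ≤ β →
      0 ≤ (1 / lam) * klReal (Q N S (β * lam)) (Q N S 0)) ∧
    (∀ β₁ β₂ : ℝ, 0 ≤ β₁ → β₁ ≤ β₂ →
      (1 / lam) * klReal (Q N S (β₁ * lam)) (Q N S 0)
        ≤ (1 / lam) * klReal (Q N S (β₂ * lam)) (Q N S 0)) ∧
    (∀ β₁ β₂ : ℝ, 0 ≤ β₁ → 0 ≤ β₂ →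
      |(1 / lam) * klReal (Q N S (β₁ * lam)) (Q N S 0)
        - (1 / lam) * klReal (Q N S (β₂ * lam)) (Q N S 0)|
        ≤ (1 / 2) * |β₁ - β₂|) := by
  have main : ∀ β₁ β₂ : ℝ, 0 ≤ β₁ → β₁ ≤ β₂ →
      (1 / lam) * klReal (Q N S (β₁ * lam)) (Q N S 0)
        ≤ (1 / lam) * klReal (Q N S (β₂ * lam)) (Q N S 0) ∧
      (1 / lam) * klReal (Q N S (β₂ * lam)) (Q N S 0)
        - (1 / lam) * klReal (Q N S (β₁ * lam)) (Q N S 0) ≤ (1 / 2) * (β₂ - β₁) := by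
    intro β₁ β₂ h0 h
    obtain ⟨h1, h2⟩ := klReal_main hne hsphere (β₁ * lam) (β₂ * lam) (by positivity)
      (mul_le_mul_of_nonneg_right h hlam.le)
    refine ⟨mul_le_mul_of_nonneg_left h1 (by positivity), ?_⟩
    rw [← mul_sub]
    refine (mul_le_mul_of_nonneg_left h2 (by positivity)).trans (le_of_eq ?_)
    field_simp
  refine ⟨fun β _ => ?_, fun β₁ β₂ h0 h => (main β₁ β₂ h0 h).1, fun β₁ β₂ h1 h2 => ?_⟩
  · rw [klReal_eq hne]
    positivity
  · rcases le_total β₁ β₂ with h | h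
    · obtain ⟨a, b⟩ := main β₁ β₂ h1 h
      rw [abs_sub_comm, abs_of_nonneg (sub_nonneg.mpr a), abs_sub_comm,
        abs_of_nonneg (sub_nonneg.mpr h)]
      exact b
    · obtain ⟨a, b⟩ := main β₂ β₁ h2 h
      rw [abs_of_nonneg (sub_nonneg.mpr a), abs_of_nonneg (sub_nonneg.mpr h)]
      exact b
end
end

section
/- Let (α₁(N))_{N∈ℕ} and (α₂(N))_{N∈ℕ} be sequences in (0,1) with α₁(N) → 1 and α₂(N) → 0 as N → ∞, and let (λ_N) be a sequence tending to infinity such that the sequence (1/λ_N)·d(α₁(N) ‖ α₂(N)) is bounded. Then limsup_{N→∞} (1/λ_N)·d(α₁(N) ‖ α₂(N)) = limsup_{N→∞} (1/λ_N)·log(1/α₂(N)). -/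
open Filter

noncomputable section

/-- The binary Kullback–Leibler divergence
`d(a ‖ b) = a log(a/b) + (1-a) log((1-a)/(1-b))`. -/
def binKL (a b : ℝ) : ℝ := a * Real.log (a / b) + (1 - a) * Real.log ((1 - a) / (1 - b))

/-- Lemma 4 of the paper. If `α₁(N) → 1`, `α₂(N) → 0`, with values in
`(0,1)`, `λ_N → ∞` and `(1/λ_N) d(α₁(N) ‖ α₂(N))` is bounded, then
`limsup_N (1/λ_N) d(α₁(N) ‖ α₂(N)) = limsup_N (1/λ_N) log(1/α₂(N))`. -/
theorem statement14 (α₁ α₂ : ℕ → ℝ)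
    (h1 : ∀ N, α₁ N ∈ Set.Ioo (0 : ℝ) 1) (h2 : ∀ N, α₂ N ∈ Set.Ioo (0 : ℝ) 1)
    (hl1 : Tendsto α₁ atTop (nhds 1)) (hl2 : Tendsto α₂ atTop (nhds 0))
    (lam : ℕ → ℝ) (hlam : Tendsto lam atTop atTop)
    (hbdd : ∃ C : ℝ, ∀ N, |binKL (α₁ N) (α₂ N) / lam N| ≤ C) :
    Filter.limsup (fun N => binKL (α₁ N) (α₂ N) / lam N) atTop
      = Filter.limsup (fun N => Real.log (1 / α₂ N) / lam N) atTop := by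
  obtain ⟨C, hC⟩ := hbdd
  set u : ℕ → ℝ := fun N => binKL (α₁ N) (α₂ N) / lam N with hu
  set r : ℕ → ℝ := fun N => α₁ N * Real.log (α₁ N) + (1 - α₁ N) * Real.log (1 - α₁ N)
    - (1 - α₁ N) * Real.log (1 - α₂ N) with hr
  set w : ℕ → ℝ := fun N => u N * ((α₁ N)⁻¹ - 1) - r N * (lam N)⁻¹ * (α₁ N)⁻¹ with hw
  have hv : (fun N => Real.log (1 / α₂ N) / lam N) = u + w := by
    funext N
    obtain ⟨ha0, ha1⟩ := h1 N
    obtain ⟨hb0, hb1⟩ := h2 N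
    have e1 : Real.log (α₁ N / α₂ N) = Real.log (α₁ N) - Real.log (α₂ N) :=
      Real.log_div ha0.ne' hb0.ne'
    have e2 : Real.log ((1 - α₁ N) / (1 - α₂ N)) = Real.log (1 - α₁ N) - Real.log (1 - α₂ N) :=
      Real.log_div (by linarith) (by linarith)
    have ha : α₁ N * (α₁ N)⁻¹ = 1 := mul_inv_cancel₀ ha0.ne'
    simp only [Pi.add_apply, hw, hu, hr, binKL, e1, e2, one_div, Real.log_inv]
    linear_combination (Real.log (α₂ N) * (lam N)⁻¹) * ha
  have ha : Tendsto (fun N => (α₁ N)⁻¹) atTop (nhds 1) := by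
    simpa using hl1.inv₀ one_ne_zero
  have h1a : Tendsto (fun N => 1 - α₁ N) atTop (nhds 0) := by
    simpa using hl1.const_sub 1
  have h1b : Tendsto (fun N => 1 - α₂ N) atTop (nhds 1) := by
    simpa using hl2.const_sub 1
  have hr0 : Tendsto r atTop (nhds 0) := by
    have t1 := (Real.continuous_mul_log.tendsto 1).comp hl1
    have t2 := (Real.continuous_mul_log.tendsto 0).comp h1a
    have t3 := h1a.mul (h1b.log one_ne_zero)
    simpa [Function.comp_def] using (t1.add t2).sub t3
  have hw0 : Tendsto w atTop (nhds 0) := by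
    have t1 : Tendsto (fun N => u N * ((α₁ N)⁻¹ - 1)) atTop (nhds 0) := by
      have hz : Tendsto (fun N => C * |(α₁ N)⁻¹ - 1|) atTop (nhds 0) := by
        simpa using ((ha.sub_const 1).abs).const_mul C
      refine squeeze_zero_norm (fun N => ?_) hz
      rw [Real.norm_eq_abs, abs_mul]
      exact mul_le_mul_of_nonneg_right (hC N) (abs_nonneg _)
    have t2 := (hr0.mul hlam.inv_tendsto_atTop).mul ha
    simpa using t1.sub t2
  have hub : IsBoundedUnder (· ≤ ·) atTop u :=
    isBoundedUnder_of ⟨C, fun N => (abs_le.1 (hC N)).2⟩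
  have hlb : IsBoundedUnder (· ≥ ·) atTop u :=
    isBoundedUnder_of ⟨-C, fun N => (abs_le.1 (hC N)).1⟩
  rw [hv]
  apply le_antisymm
  · have := le_limsup_add hub hlb.isCoboundedUnder_le hw0.isBoundedUnder_le hw0.isBoundedUnder_ge
    rwa [hw0.liminf_eq, add_zero] at this
  · have := limsup_add_le hlb hub hw0.isBoundedUnder_ge.isCoboundedUnder_le hw0.isBoundedUnder_le
    rwa [hw0.limsup_eq, add_zero] at this
end
end

section
/- Let N ∈ ℕ and let S be a finite nonempty subset of the unit sphere of ℝ^N with cardinality M. If Z ∈ ℝ^N is a standard Gaussian vector, then E[max_{x ∈ S} ⟨x, Z⟩²] ≤ 2·log M + 2. -/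
open MeasureTheory ProbabilityTheory Filter Real
open scoped ENNReal NNReal

noncomputable section

lemma aux_law {N : ℕ} (x : V N) (hx : ∑ i, (x i) ^ 2 = 1) :
    (Measure.pi fun _ : Fin N => gaussianReal 0 1).map (inp x) = gaussianReal 0 1 := by
  have hm : Measurable (inp x) := by unfold inp; fun_prop
  haveI : IsProbabilityMeasure ((Measure.pi fun _ : Fin N => gaussianReal 0 1).map (inp x)) :=
    Measure.isProbabilityMeasure_map hm.aemeasurable
  apply Measure.ext_of_charFun
  ext t
  have h := charFun_stdGaussian (E := EuclideanSpace ℝ (Fin N)) (WithLp.toLp 2 (t • x))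
  rw [← map_pi_eq_stdGaussian, charFun_apply, integral_map (by fun_prop) (by fun_prop)] at h
  rw [charFun_gaussianReal, charFun_apply, integral_map hm.aemeasurable (by fun_prop)]
  have h2 : ‖(WithLp.toLp 2 (t • x) : EuclideanSpace ℝ (Fin N))‖ ^ 2 = t ^ 2 := by
    rw [EuclideanSpace.norm_sq_eq]
    simp [mul_pow, ← Finset.mul_sum, hx]
  rw [← Complex.ofReal_pow, h2] at h
  convert h using 1
  · congr 1
    ext z
    congr 3
    simp [inp, PiLp.inner_apply, Finset.mul_sum]
    exact Finset.sum_congr rfl fun i _ => by ring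
  · simp [neg_div]

lemma aux_i0 : Integrable (fun x : ℝ => exp (-(1/2) * x ^ 2)) := integrable_exp_neg_mul_sq (by norm_num)
lemma aux_i1 : Integrable (fun x : ℝ => x * exp (-(1/2) * x ^ 2)) :=
  integrable_mul_exp_neg_mul_sq (by norm_num)
lemma aux_i2 : Integrable (fun x : ℝ => x ^ 2 * exp (-(1/2) * x ^ 2)) := by
  have := integrable_rpow_mul_exp_neg_mul_sq (b := 1/2) (by norm_num) (s := 2) (by norm_num)
  simpa using this

lemma aux_tail (b : ℝ) (hb : 0 ≤ b) :
    ∫ x in Set.Ioi b, exp (-(1/2) * x ^ 2) ≤ exp (-(1/2) * b ^ 2) * (√(2 * π) / 2) := by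
  have h1 : ∫ x in Set.Ioi b, exp (-(1/2) * x ^ 2)
      = ∫ x in Set.Ioi (0:ℝ), exp (-(1/2) * (x + b) ^ 2) := by
    have := (measurePreserving_add_right volume b).setIntegral_preimage_emb
      (measurableEmbedding_addRight b) (fun x => exp (-(1/2) * x ^ 2)) (Set.Ioi b)
    rw [← this]
    simp
  rw [h1]
  have h2 := integral_gaussian_Ioi (1/2)
  rw [show π / (1/2) = 2 * π by ring] at h2
  rw [← h2, ← integral_const_mul]
  apply setIntegral_mono_on
  · exact (aux_i0.comp_add_right b).integrableOn
  · exact (aux_i0.const_mul _).integrableOn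
  · exact measurableSet_Ioi
  · intro x hx
    rw [← exp_add]
    apply exp_le_exp.mpr
    have : 0 ≤ x * b := mul_nonneg (le_of_lt hx) hb
    nlinarith

lemma aux_half (b : ℝ) (hb : 0 ≤ b) :
    ∫ x in Set.Ioi b, (x ^ 2 - b ^ 2) * exp (-(1/2) * x ^ 2)
      ≤ exp (-(1/2) * b ^ 2) * √(2 * π) := by
  have hder : ∀ x : ℝ, HasDerivAt (fun x => -2 * (x - b) * exp (-(1/2) * x ^ 2))
      (2 * x * (x - b) * exp (-(1/2) * x ^ 2) - 2 * exp (-(1/2) * x ^ 2)) x := by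
    intro x
    have h1 : HasDerivAt (fun x : ℝ => -2 * (x - b)) (-2) x := by
      simpa using ((hasDerivAt_id x).sub_const b).const_mul (-2)
    have h2 : HasDerivAt (fun x : ℝ => exp (-(1/2) * x ^ 2))
        (exp (-(1/2) * x ^ 2) * (-(1/2) * (2 * x))) x := by
      have h3 := ((hasDerivAt_pow 2 x).const_mul (-(1/2))).exp
      refine h3.congr_deriv ?_
      norm_num
    refine (h1.mul h2).congr_deriv ?_
    ring
  have hf : Integrable (fun x : ℝ => -2 * (x - b) * exp (-(1/2) * x ^ 2)) := by
    refine ((aux_i1.const_mul (-2)).add (aux_i0.const_mul (2 * b))).congr (.of_forall fun x => ?_)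
    simp only [Pi.add_apply]; ring
  have hA : Integrable (fun x : ℝ => 2 * x * (x - b) * exp (-(1/2) * x ^ 2)) := by
    refine ((aux_i2.const_mul 2).sub (aux_i1.const_mul (2 * b))).congr (.of_forall fun x => ?_)
    simp only [Pi.sub_apply]; ring
  have hB : Integrable (fun x : ℝ => 2 * exp (-(1/2) * x ^ 2)) := aux_i0.const_mul 2
  have hf' := hA.sub hB
  have ht := tendsto_zero_of_hasDerivAt_of_integrableOn_Ioi (a := b) (fun x _ => hder x)
    hf'.integrableOn hf.integrableOn
  have hint := integral_Ioi_of_hasDerivAt_of_tendsto' (a := b) (fun x _ => hder x)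
    hf'.integrableOn ht
  rw [integral_sub hA.integrableOn hB.integrableOn, integral_const_mul] at hint
  have := aux_tail b hb
  have hle : ∫ x in Set.Ioi b, (x ^ 2 - b ^ 2) * exp (-(1/2) * x ^ 2)
      ≤ ∫ x in Set.Ioi b, 2 * x * (x - b) * exp (-(1/2) * x ^ 2) := by
    apply setIntegral_mono_on _ hA.integrableOn measurableSet_Ioi
    · intro x hx
      apply mul_le_mul_of_nonneg_right _ (exp_pos _).le
      nlinarith [sq_nonneg (x - b)]
    · apply Integrable.integrableOn
      refine (aux_i2.sub (aux_i0.const_mul (b ^ 2))).congr (.of_forall fun x => ?_)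
      simp only [Pi.sub_apply]; ring
  have h0 : -2 * (b - b) * exp (-(1/2) * b ^ 2) = 0 := by simp
  linarith

lemma aux_gauss (b : ℝ) (hb : 0 ≤ b) :
    ∫ x, max (x ^ 2 - b ^ 2) 0 ∂(gaussianReal 0 1) ≤ 2 * exp (-(1/2) * b ^ 2) := by
  rw [integral_gaussianReal_eq_integral_smul one_ne_zero]
  have e : ∀ x : ℝ, gaussianPDFReal 0 1 x • max (x ^ 2 - b ^ 2) 0
      = (√(2 * π))⁻¹ * (max (|x| ^ 2 - b ^ 2) 0 * exp (-(1/2) * |x| ^ 2)) := by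
    intro x
    rw [gaussianPDFReal, smul_eq_mul, sq_abs]
    simp only [NNReal.coe_one, mul_one, sub_zero]
    rw [show -x ^ 2 / 2 = -(1/2) * x ^ 2 by ring]
    ring
  simp_rw [e]
  rw [integral_const_mul,
    integral_comp_abs (f := fun x => max (x ^ 2 - b ^ 2) 0 * exp (-(1/2) * x ^ 2))]
  have h1 : ∫ x in Set.Ioi (0:ℝ), max (x ^ 2 - b ^ 2) 0 * exp (-(1/2) * x ^ 2)
      = ∫ x in Set.Ioi b, (x ^ 2 - b ^ 2) * exp (-(1/2) * x ^ 2) := by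
    refine (setIntegral_eq_of_subset_of_forall_sdiff_eq_zero
      (f := fun x : ℝ => max (x ^ 2 - b ^ 2) 0 * exp (-(1/2) * x ^ 2)) measurableSet_Ioi
      (Set.Ioi_subset_Ioi hb) ?_).trans ?_
    rotate_left
    · apply setIntegral_congr_fun measurableSet_Ioi
      intro x hx
      have hx : b < x := hx
      simp only
      rw [max_eq_left]
      nlinarith
    · rintro x ⟨hx, hx'⟩
      have hx : 0 < x := hx
      have hx' : x ≤ b := not_lt.mp hx'
      rw [max_eq_right, zero_mul]
      nlinarith
  rw [h1]
  have h2 := aux_half b hb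
  have hp : 0 < √(2 * π) := by positivity
  rw [inv_mul_le_iff₀ hp]
  linarith

/-- Lemma 5 of the paper. If `S` is a finite nonempty subset of the unit
sphere of `ℝ^N` with cardinality `M` and `Z` is a standard Gaussian vector, then
`E[max_{x ∈ S} ⟨x, Z⟩²] ≤ 2 log M + 2`. -/
theorem statement15 (N : ℕ) (S : Finset (V N)) (hne : S.Nonempty) (hsphere : onSphere S) :
    ∫ z, (S.sup' hne fun x => (inp x z) ^ 2) ∂(stdGaussian N)
      ≤ 2 * Real.log S.card + 2 := by
  have hM : (1:ℝ) ≤ S.card := by exact_mod_cast hne.card_pos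
  have hlog : 0 ≤ Real.log S.card := Real.log_nonneg hM
  set b := √(2 * Real.log S.card) with hbdef
  have hb2 : b ^ 2 = 2 * Real.log S.card := Real.sq_sqrt (by positivity)
  have hb : 0 ≤ b := Real.sqrt_nonneg _
  unfold _root_.stdGaussian
  set P := (Measure.pi fun _ : Fin N => gaussianReal 0 1) with hP
  have hm : ∀ x : V N, Measurable (inp x) := fun x => by unfold inp; fun_prop
  have hgi : Integrable (fun y : ℝ => max (y ^ 2 - b ^ 2) 0) (gaussianReal 0 1) := by
    have : Integrable (fun y : ℝ => y ^ 2) (gaussianReal 0 1) :=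
      (memLp_id_gaussianReal 2).integrable_sq
    exact (this.sub (integrable_const _)).sup (integrable_const 0)
  have hi : ∀ x ∈ S, Integrable (fun z => max (inp x z ^ 2 - b ^ 2) 0) P := by
    intro x hx
    rw [← aux_law x (hsphere x hx)] at hgi
    exact hgi.comp_measurable (hm x)
  have hint : ∀ x ∈ S, ∫ z, max (inp x z ^ 2 - b ^ 2) 0 ∂P ≤ 2 * exp (-(1/2) * b ^ 2) := by
    intro x hx
    have h := aux_gauss b hb
    rw [← aux_law x (hsphere x hx), integral_map (hm x).aemeasurable (by fun_prop)] at h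
    exact h
  calc ∫ z, (S.sup' hne fun x => (inp x z) ^ 2) ∂P
      ≤ ∫ z, (b ^ 2 + ∑ x ∈ S, max (inp x z ^ 2 - b ^ 2) 0) ∂P := by
        apply integral_mono_of_nonneg
        · filter_upwards with z
          obtain ⟨x, hx⟩ := hne
          exact (sq_nonneg (inp x z)).trans (Finset.le_sup' (fun x => (inp x z) ^ 2) hx)
        · exact (integrable_const _).add (integrable_finsetSum _ hi)
        · filter_upwards with z
          apply Finset.sup'_le
          intro x hx
          have h1 := Finset.single_le_sum (f := fun x => max (inp x z ^ 2 - b ^ 2) 0)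
            (fun y _ => le_max_right _ _) hx
          have h2 := le_max_left (inp x z ^ 2 - b ^ 2) 0
          linarith
    _ = b ^ 2 + ∑ x ∈ S, ∫ z, max (inp x z ^ 2 - b ^ 2) 0 ∂P := by
        rw [integral_add (integrable_const _) (integrable_finsetSum _ hi),
          integral_finsetSum _ hi]
        simp
    _ ≤ b ^ 2 + ∑ x ∈ S, 2 * exp (-(1/2) * b ^ 2) := by
        gcongr with x hx
        exact hint x hx
    _ = 2 * Real.log S.card + 2 := by
        rw [hb2, Finset.sum_const, nsmul_eq_mul,
          show -(1/2) * (2 * Real.log S.card) = -Real.log S.card by ring, exp_neg,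
          exp_log (by linarith)]
        field_simp
end
end
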